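/- arXiv:math/0510484 — 4 statements merged into one kernel-verified Lean document; each statement's English description precedes it below -/
import Mathlib

section
/- If 𝔱 = 𝔟, then there exists a nonmeager simple P-filter on ℕ. -/
open Set Cardinal

/-- `A ⊆* B` : almost inclusion, i.e. `A \ B` is finite. -/
def AlmostSub (A B : Set ℕ) : Prop := (A \ B).Finite

/-- The Marczewski map: `mu u x = {n | x ∈ u n}`. -/
def mu {X : Type*} (u : ℕ → Set X) (x : X) : Set ℕ := {n | x ∈ u n}

/-- `u` is a γ-cover: every `mu u x` is cofinite. -/
def IsGammaCover {X : Type*} (u : ℕ → Set X) : Prop :=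
  ∀ x : X, (mu u x)ᶜ.Finite

/-- `u` is an ω-cover: the family `mu u '' X` is centered. -/
def IsOmegaCover {X : Type*} (u : ℕ → Set X) : Prop :=
  ∀ K : Finset X, (⋂ x ∈ K, mu u x).Infinite

/-- `u` is a τ-cover. -/
def IsTauCover {X : Type*} (u : ℕ → Set X) : Prop :=
  (∀ x : X, (mu u x).Infinite) ∧
  ∀ x₁ x₂ : X, AlmostSub (mu u x₁) (mu u x₂) ∨ AlmostSub (mu u x₂) (mu u x₁)

/-- A family of sets of naturals is linearly preordered by `⊆*`. -/
def LinearAlmost (J : Set (Set ℕ)) : Prop :=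
  ∀ A ∈ J, ∀ B ∈ J, AlmostSub A B ∨ AlmostSub B A

/-- `u` is a τ*-cover: some family `J` of infinite subsets of `ℕ`, linearly
preordered by `⊆*`, refines `mu u '' X`. -/
def IsTauAstCover {X : Type*} (u : ℕ → Set X) : Prop :=
  ∃ J : Set (Set ℕ), (∀ A ∈ J, A.Infinite) ∧ LinearAlmost J ∧
    ∀ x : X, ∃ A ∈ J, A ⊆ mu u x

/-- `u` is a τ⋆-cover: some family `J ⊆ mu u '' X` of infinite subsets of `ℕ`,
linearly preordered by `⊆*`, refines `mu u '' X`. -/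
def IsTauStarCover {X : Type*} (u : ℕ → Set X) : Prop :=
  ∃ J : Set (Set ℕ), J ⊆ Set.range (mu u) ∧ (∀ A ∈ J, A.Infinite) ∧ LinearAlmost J ∧
    ∀ x : X, ∃ A ∈ J, A ⊆ mu u x

/-- An open cover of the whole space. -/
def IsOpenCover {X : Type*} [TopologicalSpace X] (u : Set (Set X)) : Prop :=
  (∀ U ∈ u, IsOpen U) ∧ ⋃₀ u = Set.univ

/-- The selection principle `Ufin(O, P)` : for every sequence of open covers `u n`
there are finite `v n ⊆ u n` such that the sequence `n ↦ ⋃₀ v n` satisfies `P`. -/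
def Ufin (X : Type*) [TopologicalSpace X] (P : (ℕ → Set X) → Prop) : Prop :=
  ∀ u : ℕ → Set (Set X), (∀ n, IsOpenCover (u n)) →
    ∃ v : ℕ → Set (Set X), (∀ n, (v n).Finite ∧ v n ⊆ u n) ∧ P (fun n => ⋃₀ v n)

/-- The Menger property `Ufin(O,O)`. -/
def UfinO (X : Type*) [TopologicalSpace X] : Prop :=
  Ufin X (fun w => ∀ x : X, ∃ n, x ∈ w n)

/-- The Hurewicz property `Ufin(O,Γ)`. -/
def UfinGamma (X : Type*) [TopologicalSpace X] : Prop := Ufin X IsGammaCover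

/-- `Ufin(O,Ω)`. -/
def UfinOmega (X : Type*) [TopologicalSpace X] : Prop := Ufin X IsOmegaCover

/-- `Ufin(O,T)`. -/
def UfinTau (X : Type*) [TopologicalSpace X] : Prop := Ufin X IsTauCover

/-- `Ufin(O,T*)`. -/
def UfinTauAst (X : Type*) [TopologicalSpace X] : Prop := Ufin X IsTauAstCover

/-- `Ufin(O,T⋆)`. -/
def UfinTauStar (X : Type*) [TopologicalSpace X] : Prop := Ufin X IsTauStarCover

/-- The upward `⊆*`-closure of a family of subsets of `ℕ`. -/
def upCl (A : Set (Set ℕ)) : Set (Set ℕ) := {B | ∃ a ∈ A, AlmostSub a B}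

/-- A semifilter on `ℕ`. -/
def IsSemifilter (F : Set (Set ℕ)) : Prop :=
  (∀ A ∈ F, A.Nonempty) ∧ ∀ A ∈ F, ∀ B : Set ℕ, AlmostSub A B → B ∈ F

/-- A filter on `ℕ` (in the semifilter sense): a semifilter closed under finite
intersections. -/
def IsFilterFam (F : Set (Set ℕ)) : Prop :=
  IsSemifilter F ∧ ∀ A ∈ F, ∀ B ∈ F, A ∩ B ∈ F

/-- A simple P-filter: a filter consisting of infinite sets with a base linearly
preordered by `⊆*`. -/
def IsSimplePFilter (F : Set (Set ℕ)) : Prop :=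
  IsFilterFam F ∧ (∀ A ∈ F, A.Infinite) ∧
  ∃ B : Set (Set ℕ), B ⊆ F ∧ F = upCl B ∧ LinearAlmost B

/-- A family of subsets of `ℕ` is meager if the corresponding set of
characteristic functions is meager in the Cantor space `ℕ → Bool`. -/
def MeagerFam (F : Set (Set ℕ)) : Prop :=
  IsMeagre {f : ℕ → Bool | {n | f n = true} ∈ F}

/-- A family of subsets of `ℕ` is comeager if the corresponding set of
characteristic functions is comeager in the Cantor space `ℕ → Bool`. -/
def ComeagerFam (F : Set (Set ℕ)) : Prop :=
  {f : ℕ → Bool | {n | f n = true} ∈ F} ∈ residual (ℕ → Bool)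

/-- `x ≤* y` : eventual dominance. -/
def evLE (x y : ℕ → ℕ) : Prop := {n | y n < x n}.Finite

/-- The unbounding number `𝔟`. -/
noncomputable def cardB : Cardinal :=
  sInf {c | ∃ S : Set (ℕ → ℕ), c = #S ∧ ¬ ∃ y : ℕ → ℕ, ∀ x ∈ S, evLE x y}

/-- The dominating number `𝔡`. -/
noncomputable def cardD : Cardinal :=
  sInf {c | ∃ S : Set (ℕ → ℕ), c = #S ∧ ∀ x : ℕ → ℕ, ∃ y ∈ S, evLE x y}

/-- The ultrafilter number `𝔲`. -/
noncomputable def cardU : Cardinal :=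
  sInf {c | ∃ (U : Ultrafilter ℕ) (B : Set (Set ℕ)), c = #B ∧
    (∀ A ∈ U, A.Infinite) ∧ (∀ b ∈ B, b ∈ U) ∧ ∀ A ∈ U, ∃ b ∈ B, b ⊆ A}

/-- A groupwise dense family of infinite subsets of `ℕ`. -/
def IsGroupwiseDense (G : Set (Set ℕ)) : Prop :=
  (∀ A ∈ G, A.Infinite) ∧
  (∀ A ∈ G, ∀ B : Set ℕ, B.Infinite → B ⊆ A → B ∈ G) ∧
  ∀ k : ℕ → ℕ, StrictMono k →
    ∃ S : Set ℕ, S.Infinite ∧ (⋃ n ∈ S, Set.Ico (k n) (k (n + 1))) ∈ G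

/-- The groupwise density number `𝔤`. -/
noncomputable def cardG : Cardinal :=
  sInf {c | ∃ 𝒢 : Set (Set (Set ℕ)), c = #𝒢 ∧ (∀ G ∈ 𝒢, IsGroupwiseDense G) ∧ ⋂₀ 𝒢 = ∅}

/-- A tower of length `lam`: a `⊆*`-decreasing transfinite sequence of infinite
subsets of `ℕ` indexed by the ordinals below `lam`. -/
def IsTower (lam : Ordinal) (T : Ordinal → Set ℕ) : Prop :=
  (∀ α < lam, (T α).Infinite) ∧
  ∀ β α : Ordinal, β ≤ α → α < lam → AlmostSub (T α) (T β)

/-- `Depth⁺([ω]^{ℵ₀})`: the least cardinal `κ` such that there is no tower of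
length `κ`. -/
noncomputable def depthPlus : Cardinal :=
  sInf {c : Cardinal | ¬ ∃ T : Ordinal → Set ℕ, IsTower c.ord T}

/-- The tower number `𝔱`: the least length of a tower with no infinite
pseudo-intersection. -/
noncomputable def cardT : Cardinal :=
  sInf {c : Cardinal | ∃ T : Ordinal → Set ℕ, IsTower c.ord T ∧
    ¬ ∃ A : Set ℕ, A.Infinite ∧ ∀ α < c.ord, AlmostSub A (T α)}

/-- The trace of a family on the intervals determined by `k`. -/
def intervalTrace (k : ℕ → ℕ) (F : Set (Set ℕ)) : Set (Set ℕ) :=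
  {S | ∃ A ∈ F, S = {n | (A ∩ Set.Ico (k n) (k (n + 1))).Nonempty}}

/-- The Filter Dichotomy principle. -/
def FilterDichotomy : Prop :=
  ∀ F U : Set (Set ℕ), IsFilterFam F → IsFilterFam U →
    ¬ MeagerFam F → ¬ ComeagerFam F → ¬ MeagerFam U → ¬ ComeagerFam U →
    ∃ k : ℕ → ℕ, StrictMono k ∧ intervalTrace k F = intervalTrace k U

/-- `B` is `u`-bounded: `B` is contained in the union of a finite subfamily of `u`. -/
def BoundedBy {X : Type*} (u : Set (Set X)) (B : Set X) : Prop :=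
  ∃ v : Set (Set X), v ⊆ u ∧ v.Finite ∧ B ⊆ ⋃₀ v

/-- The weak excluded middle property of a subset of the Baire space. -/
def WeakExcludedMiddle (Z : Set (ℕ → ℕ)) : Prop :=
  ∃ x : ℕ → ℕ, ∃ F : Set (Set ℕ), IsSimplePFilter F ∧ ∀ z ∈ Z, {n | z n ≤ x n} ∈ F

/-- `B` is sparse for `f`: past each `a ∈ B`, the next element of `B` exceeds `f m` for all `m ≤ a`. -/
def IsSparseFor (f : ℕ → ℕ) (B : Set ℕ) : Prop :=
  ∀ m : ℕ, ∀ a ∈ B, ∀ b ∈ B, m ≤ a → a < b → f m < b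

theorem AlmostSub.of_subset {A B : Set ℕ} (h : A ⊆ B) : AlmostSub A B := by
  simp [AlmostSub, sdiff_eq_empty.mpr h]

theorem AlmostSub.trans {A B C : Set ℕ} (hAB : AlmostSub A B) (hBC : AlmostSub B C) :
    AlmostSub A C := by
  refine (Finite.union hAB hBC).subset fun x hx => ?_
  by_cases hB : x ∈ B
  · exact Or.inr ⟨hB, hx.2⟩
  · exact Or.inl ⟨hx.1, hB⟩

theorem AlmostSub.inter {A B C : Set ℕ} (hB : AlmostSub A B) (hC : AlmostSub A C) :
    AlmostSub A (B ∩ C) := by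
  unfold AlmostSub
  rw [sdiff_inter]
  exact Finite.union hB hC

theorem AlmostSub.infinite {A B : Set ℕ} (h : AlmostSub A B) (hA : A.Infinite) : B.Infinite := by
  intro hB
  refine hA ((Finite.union h hB).subset fun x hx => ?_)
  by_cases hxB : x ∈ B
  · exact Or.inr hxB
  · exact Or.inl ⟨hx, hxB⟩

/-- The upward closure of a linearly preordered family of infinite sets is a simple P-filter. -/
theorem isSimplePFilter_upCl {J : Set (Set ℕ)} (hinf : ∀ A ∈ J, A.Infinite)
    (hlin : LinearAlmost J) : IsSimplePFilter (upCl J) := by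
  have hinf' : ∀ A ∈ upCl J, A.Infinite := fun A ⟨a, ha, haA⟩ => haA.infinite (hinf a ha)
  refine ⟨⟨⟨fun A hA => (hinf' A hA).nonempty, ?_⟩, ?_⟩, hinf', J, ?_, rfl, hlin⟩
  · rintro A ⟨a, ha, haA⟩ B hAB
    exact ⟨a, ha, haA.trans hAB⟩
  · rintro A ⟨a, ha, haA⟩ B ⟨b, hb, hbB⟩
    rcases hlin a ha b hb with hab | hba
    · exact ⟨a, ha, haA.inter (hab.trans hbB)⟩
    · exact ⟨b, hb, (hba.trans haA).inter hbB⟩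
  · exact fun A hA => ⟨A, hA, .of_subset subset_rfl⟩

theorem exists_infinite_isSparseFor (f : ℕ → ℕ) {A : Set ℕ} (hA : A.Infinite) :
    ∃ B ⊆ A, B.Infinite ∧ IsSparseFor f B := by
  obtain ⟨b, hbA, hb⟩ := exists_seq_of_forall_finset_exists (· ∈ A)
    (fun x y => x < y ∧ ∀ m ≤ x, f m < y) fun s _ => by
      obtain ⟨y, hyA, hy⟩ :=
        hA.exists_gt (s.sup fun x => x + (Finset.range (x + 1)).sup f)
      refine ⟨y, hyA, fun x hx => ?_⟩
      have hxy : x + (Finset.range (x + 1)).sup f < y :=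
        (Finset.le_sup (f := fun x => x + (Finset.range (x + 1)).sup f) hx).trans_lt hy
      refine ⟨by omega, fun m hm => ?_⟩
      have : f m ≤ (Finset.range (x + 1)).sup f :=
        Finset.le_sup (f := f) (Finset.mem_range.mpr (by omega))
      omega
  have hmono : StrictMono b := fun m n hmn => (hb m n hmn).1
  refine ⟨range b, range_subset_iff.mpr hbA, infinite_range_of_injective hmono.injective, ?_⟩
  rintro m _ ⟨i, rfl⟩ _ ⟨j, rfl⟩ hm hij
  exact (hb i j (hmono.lt_iff_lt.mp hij)).2 m hm

/-- If a set sparse for `f` meets almost all intervals of a partition, then the partition gives a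
bound on `f` that does not depend on the set. -/
theorem evLE_of_isSparseFor {f : ℕ → ℕ} {A : Set ℕ} (hA : IsSparseFor f A) {k : ℕ → ℕ}
    (hk : StrictMono k) {N : ℕ} (hN : ∀ n ≥ N, (A ∩ Ico (k n) (k (n + 1))).Nonempty) :
    evLE f fun m => k (m + 3) := by
  refine (finite_lt_nat N).subset fun m hm => ?_
  by_contra hmN
  simp only [mem_ofPred_eq, not_lt] at hm hmN
  obtain ⟨a, haA, ha⟩ := hN (m + 1) (by omega)
  obtain ⟨b, hbA, hb⟩ := hN (m + 2) (by omega)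
  have hkm := hk.le_apply (x := m + 1)
  have := hA m a haA b hbA (by grind) (by grind)
  grind

/-- A dense open set contains, for each `k`, every sequence carrying a suitable finite pattern
past `k`. -/
theorem exists_pattern {U : Set (ℕ → Bool)} (hU : IsOpen U) (hd : Dense U) (k : ℕ) :
    ∃ k' > k, ∃ p : ℕ → Bool, ∀ y : ℕ → Bool, (∀ i, k ≤ i → i < k' → y i = p i) → y ∈ U := by
  classical
  have key : ∀ Q : Finset (Fin k → Bool), ∃ k' > k, ∃ p : ℕ → Bool, ∀ y : ℕ → Bool,
      (fun i : Fin k => y i) ∈ Q → (∀ i, k ≤ i → i < k' → y i = p i) → y ∈ U := by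
    intro Q
    induction Q using Finset.induction_on with
    | empty => exact ⟨k + 1, by omega, fun _ => true, by simp⟩
    | insert s Q _ ih =>
      obtain ⟨k₁, hk₁, p, hp⟩ := ih
      let z : ℕ → Bool := fun i => if h : i < k then s ⟨i, h⟩ else p i
      obtain ⟨w, hwz, hwU⟩ := hd.inter_open_nonempty _
        (PiNat.isOpen_cylinder (fun _ => Bool) z k₁) ⟨z, PiNat.self_mem_cylinder z k₁⟩
      obtain ⟨_, ⟨v, k₂, rfl⟩, hwv, hvU⟩ :=
        (PiNat.isTopologicalBasis_cylinders fun _ => Bool).exists_subset_of_mem_open hwU hU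
      rw [PiNat.mem_cylinder_iff] at hwz hwv
      refine ⟨max k₁ k₂, by omega, w, fun y hyQ hyw => ?_⟩
      rcases Finset.mem_insert.mp hyQ with hys | hyQ
      · refine hvU ((PiNat.mem_cylinder_iff).mpr fun i hi => ?_)
        rw [← hwv i hi]
        by_cases hik : i < k
        · rw [hwz i (by omega)]
          simpa [z, hik] using congrFun hys ⟨i, hik⟩
        · exact hyw i (by omega) (by omega)
      · refine hp y hyQ fun i hki hi => ?_
        rw [hyw i hki (by omega), hwz i hi]
        simp [z, hki.not_gt]
  obtain ⟨k', hk', p, hp⟩ := key Finset.univ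
  exact ⟨k', hk', p, fun y => hp y (Finset.mem_univ _)⟩

/-- Talagrand's criterion, in one direction: for a meager upward closed family there is an interval
partition such that each member of the family meets almost all of its intervals. -/
theorem MeagerFam.exists_strictMono {F : Set (Set ℕ)} (hF : MeagerFam F)
    (hup : ∀ A ∈ F, ∀ B, A ⊆ B → B ∈ F) :
    ∃ k : ℕ → ℕ, StrictMono k ∧
      ∀ A ∈ F, ∃ N, ∀ n ≥ N, (A ∩ Ico (k n) (k (n + 1))).Nonempty := by
  obtain ⟨G, hGF, hG, hGd⟩ := mem_residual.mp hF
  obtain ⟨V, hVo, rfl⟩ := hG.eq_iInter_nat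
  have hWo (n : ℕ) : IsOpen (⋂ i ≤ n, V i) :=
    (finite_le_nat n).isOpen_biInter fun i _ => hVo i
  have hWd (n : ℕ) : Dense (⋂ i ≤ n, V i) :=
    hGd.mono (subset_iInter₂ fun i _ => iInter_subset V i)
  choose next hnext pat hpat using fun n => exists_pattern (hWo n) (hWd n)
  let k : ℕ → ℕ := Nat.rec 0 next
  have hk : StrictMono k := strictMono_nat_of_lt_succ fun n => hnext n (k n)
  refine ⟨k, hk, fun A hA => ?_⟩
  by_contra! hcon
  let p : ℕ → ℕ → Bool := fun n => pat n (k n)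
  let B : Set ℕ := A ∪ {i : ℕ | ∃ n, A ∩ Ico (k n) (k (n + 1)) = ∅ ∧ i ∈ Ico (k n) (k (n + 1)) ∧
    p n i = true}
  have hB : B ∈ F := hup A hA B subset_union_left
  have hy (i : ℕ) : B.boolIndicator i = true ↔ i ∈ B := (B.mem_iff_boolIndicator i).symm
  have hBV : B.boolIndicator ∈ ⋂ n, V n := by
    refine mem_iInter.mpr fun m => ?_
    obtain ⟨n, hmn, hn⟩ := hcon m
    refine mem_iInter₂.mp (hpat n (k n) _ fun i hki hi => ?_) m hmn
    have hiA : i ∉ A := fun hiA => (hn ▸ ⟨hiA, hki, hi⟩ : i ∈ (∅ : Set ℕ))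
    rw [Bool.eq_iff_iff, hy]
    constructor
    · rintro (h | ⟨n', -, ⟨h₁, h₂⟩, hp⟩)
      · exact absurd h hiA
      · have h₃ : n < n' + 1 := hk.lt_iff_lt.mp (hki.trans_lt h₂)
        have h₄ : n' < n + 1 := hk.lt_iff_lt.mp (h₁.trans_lt hi)
        obtain rfl : n' = n := by omega
        exact hp
    · exact fun hp => Or.inr ⟨n, hn, ⟨hki, hi⟩, hp⟩
  exact hGF hBV (by simpa [hy] using hB)

/-- Every tower of length less than `𝔱`, as an ordinal, has an infinite pseudo-intersection. -/
theorem IsTower.exists_pseudoIntersection {α : Ordinal} (hα : α < cardT.ord)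
    {T : Ordinal → Set ℕ} (hT : IsTower α T) :
    ∃ A : Set ℕ, A.Infinite ∧ ∀ β < α, AlmostSub A (T β) := by
  obtain ⟨f, hf⟩ := Ordinal.exists_isFundamentalSeq (o := α) rfl
  have hc : α.cof < cardT := α.cof_le_card.trans_lt (lt_ord.mp hα)
  have hmem := notMem_of_lt_csInf' hc
  let T' : Ordinal → Set ℕ := fun γ => if h : γ < α.cof.ord then T (f ⟨γ, h⟩) else univ
  have hT'f (γ : Iio α.cof.ord) : T' γ = T (f γ) := dif_pos γ.2
  have hT' : IsTower α.cof.ord T' := by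
    refine ⟨fun γ hγ => hT'f ⟨γ, hγ⟩ ▸ hT.1 _ (f ⟨γ, hγ⟩).2, fun γ δ hγδ hδ => ?_⟩
    rw [hT'f ⟨γ, hγδ.trans_lt hδ⟩, hT'f ⟨δ, hδ⟩]
    exact hT.2 _ _ (hf.strictMono.monotone hγδ) (f ⟨δ, hδ⟩).2
  obtain ⟨A, hA, hAT⟩ := not_not.mp fun hno => hmem ⟨T', hT', hno⟩
  refine ⟨A, hA, fun β hβ => ?_⟩
  obtain ⟨_, ⟨γ, rfl⟩, hγ⟩ := hf.isCofinal_range ⟨β, hβ⟩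
  exact (hT'f γ ▸ hAT γ γ.2).trans (hT.2 _ _ hγ (f γ).2)

/-- For any sequence of functions of length `𝔱` there is a tower of length `𝔱` whose terms are sparse
for the corresponding functions. -/
theorem exists_isTower_isSparseFor (f : Ordinal → ℕ → ℕ) :
    ∃ T : Ordinal → Set ℕ, IsTower cardT.ord T ∧
      ∀ α < cardT.ord, IsSparseFor (f α) (T α) := by
  classical
  let good (α : Ordinal) (T : Ordinal → Set ℕ) (B : Set ℕ) : Prop :=
    B.Infinite ∧ (∀ β < α, AlmostSub B (T β)) ∧ IsSparseFor (f α) B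
  let T : Ordinal → Set ℕ := WellFounded.fix (r := (· < ·)) Ordinal.lt_wf fun α ih =>
    Classical.epsilon (good α fun β => if h : β < α then ih β h else ∅)
  have hTeq (α : Ordinal) : T α = Classical.epsilon (good α T) := by
    have : good α (fun β => if β < α then T β else ∅) = good α T := by
      funext B
      simp +contextual only [good, if_true]
    rw [← this]
    exact WellFounded.fix_eq _ _ _
  have hT (α : Ordinal) : α < cardT.ord → good α T (T α) := by
    induction α using WellFoundedLT.induction with
    | ind α ih =>
      intro hα
      obtain ⟨A, hA, hAT⟩ := IsTower.exists_pseudoIntersection (T := T) hα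
        ⟨fun β hβ => (ih β hβ (hβ.trans hα)).1, fun γ β hγβ hβ => by
          rcases hγβ.eq_or_lt with rfl | hlt
          · exact .of_subset subset_rfl
          · exact (ih β hβ (hβ.trans hα)).2.1 γ hlt⟩
      obtain ⟨B, hBA, hB, hBf⟩ := exists_infinite_isSparseFor (f α) hA
      rw [hTeq]
      exact Classical.epsilon_spec
        (p := good α T) ⟨B, hB, fun β hβ => (AlmostSub.of_subset hBA).trans (hAT β hβ), hBf⟩
  refine ⟨T, ⟨fun α hα => (hT α hα).1, fun β α hβα hα => ?_⟩, fun α hα => (hT α hα).2.2⟩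
  rcases hβα.eq_or_lt with rfl | hlt
  · exact .of_subset subset_rfl
  · exact (hT α hα).2.1 β hlt

theorem exists_unbounded_mk_eq_cardB :
    ∃ S : Set (ℕ → ℕ), cardB = #S ∧ ¬ ∃ y : ℕ → ℕ, ∀ x ∈ S, evLE x y := by
  refine csInf_mem (s := {c | ∃ S : Set (ℕ → ℕ), c = #S ∧ ¬ ∃ y : ℕ → ℕ, ∀ x ∈ S, evLE x y})
    ⟨_, univ, rfl, fun ⟨y, hy⟩ => ?_⟩
  have h := hy (fun n => y n + 1) (mem_univ _)
  simp only [evLE, Nat.lt_add_one, ofPred_true] at h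
  exact infinite_univ h

/-- A family of functions of size `c` is enumerated along the ordinals below `c.ord`. -/
theorem exists_ordinal_enumeration {S : Set (ℕ → ℕ)} {c : Cardinal} (hS : c = #S) :
    ∃ f : Ordinal → ℕ → ℕ, ∀ s ∈ S, ∃ α < c.ord, f α = s := by
  obtain ⟨e⟩ := Cardinal.eq.mp (hS.symm.trans (mk_ord_toType c).symm)
  let g : S → Ordinal := fun s => Ordinal.typein (α := c.ord.ToType) (· < ·) (e s)
  have hg : Function.Injective g := (Ordinal.typein_injective _).comp e.injective
  exact ⟨Function.extend g Subtype.val 0, fun s hs =>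
    ⟨g ⟨s, hs⟩, Ordinal.typein_lt_self _, hg.extend_apply _ _ ⟨s, hs⟩⟩⟩

/-- If `𝔱 = 𝔟`, then there is a nonmeager simple P-filter. -/
theorem stmt_13 (h : cardT = cardB) :
    ∃ F : Set (Set ℕ), IsSimplePFilter F ∧ ¬ MeagerFam F := by
  obtain ⟨S, hS, hunb⟩ := exists_unbounded_mk_eq_cardB
  obtain ⟨f, hf⟩ := exists_ordinal_enumeration (h.trans hS)
  obtain ⟨T, hT, hTf⟩ := exists_isTower_isSparseFor f
  have hsimple : IsSimplePFilter (upCl (T '' Iio cardT.ord)) := by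
    refine isSimplePFilter_upCl (forall_mem_image.mpr hT.1) ?_
    rintro _ ⟨α, hα, rfl⟩ _ ⟨β, hβ, rfl⟩
    exact (le_total α β).symm.imp (hT.2 β α · hα) (hT.2 α β · hβ)
  refine ⟨_, hsimple, fun hmeager => hunb ?_⟩
  obtain ⟨k, hk, hmeets⟩ := hmeager.exists_strictMono
    fun A hA B hAB => hsimple.1.1.2 A hA B (.of_subset hAB)
  refine ⟨fun m => k (m + 3), fun s hs => ?_⟩
  obtain ⟨α, hα, rfl⟩ := hf s hs
  obtain ⟨N, hN⟩ := hmeets (T α) ⟨T α, mem_image_of_mem T hα, .of_subset subset_rfl⟩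
  exact evLE_of_isSparseFor (hTf α hα) hk hN
end

section
/- Let X be a topological space and (u_n)_{n∈ℕ} a sequence of open covers of X such that u_{n+1} refines u_n for each n (every member of u_{n+1} is contained in some member of u_n). Let (B_n)_{n∈ℕ} be subsets of X such that each B_n is u_n-bounded, and set w = (B_n)_{n∈ℕ}. Suppose there is an increasing sequence (k_n)_{n∈ℕ} of naturals such that for every x ∈ X the set μ_w(x) meets the half-interval [k_m, k_{m+1}) for all but finitely many m. Then, setting C_n = ⋃_{k ∈ [k_n, k_{n+1})} B_k, each C_n is u_n-bounded and the family (C_n)_{n∈ℕ} is a γ-cover of X. -/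
open Set Cardinal

theorem BoundedBy.of_refines {X : Type*} {u v : Set (Set X)} {B : Set X}
    (h : BoundedBy v B) (href : ∀ U ∈ v, ∃ V ∈ u, U ⊆ V) : BoundedBy u B := by
  obtain ⟨w, hw, hfin, hB⟩ := h
  choose! f hf hsub using href
  refine ⟨f '' w, ?_, hfin.image f, fun x hx => ?_⟩
  · rintro _ ⟨U, hU, rfl⟩
    exact hf U (hw hU)
  · obtain ⟨U, hU, hxU⟩ := hB hx
    exact ⟨f U, mem_image_of_mem f hU, hsub U (hw hU) hxU⟩

theorem BoundedBy.biUnion {X ι : Type*} {u : Set (Set X)} {s : Set ι} (hs : s.Finite)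
    {B : ι → Set X} (h : ∀ i ∈ s, BoundedBy u (B i)) : BoundedBy u (⋃ i ∈ s, B i) := by
  choose! v hv hfin hB using h
  refine ⟨⋃ i ∈ s, v i, iUnion₂_subset hv, hs.biUnion hfin, iUnion₂_subset fun i hi => ?_⟩
  exact (hB i hi).trans (sUnion_subset_sUnion (subset_biUnion_of_mem hi))

theorem BoundedBy.of_le {X : Type*} {u : ℕ → Set (Set X)}
    (href : ∀ n, ∀ U ∈ u (n + 1), ∃ V ∈ u n, U ⊆ V) {m n : ℕ} (hmn : m ≤ n) {B : Set X}
    (h : BoundedBy (u n) B) : BoundedBy (u m) B := by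
  induction n, hmn using Nat.le_induction with
  | base => exact h
  | succ n _ ih => exact ih (h.of_refines (href n))

/-- From bounded pieces whose Marczewski images meet almost all of the
half-intervals `[k m, k (m+1))` one obtains a `γ`-cover by `u n`-bounded sets. -/
theorem stmt_15 {X : Type*} [TopologicalSpace X]
    (u : ℕ → Set (Set X)) (hu : ∀ n, IsOpenCover (u n))
    (href : ∀ n, ∀ U ∈ u (n + 1), ∃ V ∈ u n, U ⊆ V)
    (B : ℕ → Set X) (hB : ∀ n, BoundedBy (u n) (B n))
    (k : ℕ → ℕ) (hk : StrictMono k)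
    (hmeets : ∀ x : X,
      {m : ℕ | ¬ (mu B x ∩ Set.Ico (k m) (k (m + 1))).Nonempty}.Finite) :
    (∀ n, BoundedBy (u n) (⋃ j ∈ Set.Ico (k n) (k (n + 1)), B j)) ∧
    IsGammaCover (fun n => ⋃ j ∈ Set.Ico (k n) (k (n + 1)), B j) := by
  refine ⟨fun n => BoundedBy.biUnion (finite_Ico _ _) fun j hj =>
    (hB j).of_le href ((hk.id_le n).trans hj.1), fun x => (hmeets x).subset fun m hm => ?_⟩
  rintro ⟨j, hxj, hj⟩
  exact hm (mem_biUnion hj hxj)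
end

section
/- Let κ be an ordinal, (b_α)_{α<κ} a sequence in ℕ^ℕ with b_β ≤* b_α whenever β ≤ α < κ, and c ∈ ℕ^ℕ such that c ≤* b_α holds for no α < κ. Then for each α < κ the set [b_α < c] = {n ∈ ℕ : b_α n < c n} is infinite, and ([b_α < c])_{α<κ} is a tower, i.e. [b_α < c] ⊆* [b_β < c] whenever β ≤ α < κ. -/
open Set Cardinal

/-- Given a `≤*`-increasing `κ`-sequence `b` and a `c` not eventually dominated
by any `b α`, the sets `[b α < c]` are infinite and form a tower. -/
theorem stmt_16 (κ : Ordinal) (b : Ordinal → ℕ → ℕ)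
    (hmono : ∀ β α : Ordinal, β ≤ α → α < κ → evLE (b β) (b α))
    (c : ℕ → ℕ) (hc : ∀ α < κ, ¬ evLE c (b α)) :
    (∀ α < κ, {n : ℕ | b α n < c n}.Infinite) ∧
    ∀ β α : Ordinal, β ≤ α → α < κ →
      AlmostSub {n : ℕ | b α n < c n} {n : ℕ | b β n < c n} := by
  refine ⟨hc, fun β α hβα hα => (hmono β α hβα hα).subset ?_⟩
  rintro n ⟨hn, hn'⟩
  simp only [Set.mem_ofPred_eq, not_lt] at hn hn' ⊢
  exact hn.trans_le hn'
end

section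
/- Assume 𝔟 < 𝔡. Then every subspace Y of the Baire space ℕ^ℕ with |Y| ≤ 𝔟 has the property Ufin(𝒪,T*). -/
open Set Cardinal

lemma evLE_trans {x y z : ℕ → ℕ} (hxy : evLE x y) (hyz : evLE y z) : evLE x z :=
  (hxy.union hyz).subset fun n hn => by
    simp only [mem_union, mem_ofPred_eq] at hn ⊢
    omega

lemma evLE_of_le {x y : ℕ → ℕ} (h : ∀ n, x n ≤ y n) : evLE x y :=
  finite_empty.subset fun n hn => absurd hn (not_lt.2 (h n))

/-- A set of fewer than `𝔟` functions is eventually bounded. -/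
lemma exists_evLE_of_lt_cardB {S : Set (ℕ → ℕ)} (hS : #S < cardB) :
    ∃ y : ℕ → ℕ, ∀ x ∈ S, evLE x y := by
  by_contra hy
  exact notMem_of_lt_csInf' hS ⟨S, rfl, hy⟩

/-- A set of fewer than `𝔡` functions is not dominating. -/
lemma exists_not_evLE_of_lt_cardD {S : Set (ℕ → ℕ)} (hS : #S < cardD) :
    ∃ x : ℕ → ℕ, ∀ y ∈ S, ¬ evLE x y := by
  by_contra! hy
  exact notMem_of_lt_csInf' hS ⟨S, rfl, hy⟩

/-- A family of at most `𝔟` functions is majorized termwise by a `≤*`-chain. -/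
lemma exists_chain_evLE {ι : Type} (hι : #ι ≤ cardB) (f : ι → ℕ → ℕ) :
    ∃ b : ι → ℕ → ℕ, (∀ i, evLE (f i) (b i)) ∧ ∀ i j, evLE (b i) (b j) ∨ evLE (b j) (b i) := by
  obtain ⟨r, hr, hord⟩ := exists_ord_eq ι
  choose! g hg using fun (S : Set (ℕ → ℕ)) => exists_evLE_of_lt_cardB (S := S)
  let b : ι → ℕ → ℕ := hr.wf.fix fun i ih n =>
    max (f i n) (g (range fun j : {j // r j i} => ih j j.2) n)
  have hb (i : ι) : b i = fun n => max (f i n) (g (range fun j : {j // r j i} => b j) n) :=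
    hr.wf.fix_eq _ i
  have hmono (i j : ι) (hij : r j i) : evLE (b j) (b i) := by
    have hcard : #(range fun j : {j // r j i} => b j) < cardB := by
      refine (mk_range_le.trans_lt ?_).trans_le hι
      exact card_typein_lt (r := r) i hord
    refine evLE_trans (hg _ hcard (b j) ⟨⟨j, hij⟩, rfl⟩) (evLE_of_le fun n => ?_)
    rw [hb i]
    exact le_max_right _ _
  refine ⟨b, fun i => evLE_of_le fun n => ?_, fun i j => ?_⟩
  · rw [hb i]
    exact le_max_left _ _
  · rcases trichotomous_of r i j with hij | rfl | hij
    · exact Or.inl (hmono j i hij)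
    · exact Or.inl (evLE_of_le fun _ => le_rfl)
    · exact Or.inr (hmono i j hij)

/-- If `𝔟 < 𝔡`, then for every family of at most `𝔟` functions there is a function `x` such that
the sets `{n | f i n ≤ x n}` are refined by a `⊆*`-linear family of infinite sets. -/
lemma exists_linearAlmost_refinement (h : cardB < cardD) {ι : Type} (hι : #ι ≤ cardB)
    (f : ι → ℕ → ℕ) :
    ∃ x : ℕ → ℕ, ∃ J : Set (Set ℕ), (∀ A ∈ J, A.Infinite) ∧ LinearAlmost J ∧
      ∀ i, ∃ A ∈ J, A ⊆ {n | f i n ≤ x n} := by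
  obtain ⟨b, hfb, hchain⟩ := exists_chain_evLE hι f
  obtain ⟨x, hx⟩ := exists_not_evLE_of_lt_cardD ((mk_range_le.trans hι).trans_lt h : #(range b) < _)
  have key (i j : ι) (s t : Set ℕ) (ht : t.Finite) (hij : evLE (b j) (b i)) :
      AlmostSub ({n | b i n < x n} \ s) ({n | b j n < x n} \ t) :=
    (ht.union hij).subset fun n hn => by
      simp only [mem_sdiff, mem_union, mem_ofPred_eq] at hn ⊢
      by_cases hnt : n ∈ t
      · exact Or.inl hnt
      · refine Or.inr (not_le.1 fun hle => hn.2 ⟨?_, hnt⟩)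
        exact hle.trans_lt hn.1.1
  refine ⟨x, {A | ∃ i, ∃ s : Set ℕ, s.Finite ∧ A = {n | b i n < x n} \ s}, ?_, ?_, fun i => ?_⟩
  · rintro _ ⟨i, s, hs, rfl⟩
    exact Set.Infinite.sdiff (hx _ ⟨i, rfl⟩) hs
  · rintro _ ⟨i, s, hs, rfl⟩ _ ⟨j, t, ht, rfl⟩
    exact (hchain i j).symm.imp (key i j s t ht) (key j i t s hs)
  · refine ⟨_, ⟨i, _, hfb i, rfl⟩, fun n hn => ?_⟩
    simp only [mem_sdiff, mem_ofPred_eq] at hn ⊢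
    omega

/-- If `𝔟 < 𝔡`, then every subspace of the Baire space of size at most `𝔟` has
the property `Ufin(O,T*)`. -/
theorem stmt_17 (h : cardB < cardD) (Y : Set (ℕ → ℕ)) (hY : #Y ≤ cardB) :
    UfinTauAst Y := by
  intro u hu
  choose T hTc hTu hT using fun n => TopologicalSpace.isOpen_sUnion_countable (u n) (hu n).1
  choose e he using fun n => countable_iff_exists_injOn.1 (hTc n)
  have hmem (y : Y) (n : ℕ) : ∃ t ∈ T n, y ∈ t := by
    rw [← mem_sUnion, hT n, (hu n).2]
    trivial
  choose t htT hyt using hmem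
  obtain ⟨x, J, hJ, hlin, href⟩ :=
    exists_linearAlmost_refinement h hY fun y n => e n (t y n)
  refine ⟨fun n => {s ∈ T n | e n s ≤ x n}, fun n => ⟨?_, fun s hs => hTu n hs.1⟩,
    J, hJ, hlin, fun y => ?_⟩
  · refine Finite.of_finite_image ((finite_Iic (x n)).subset ?_) ((he n).mono fun s hs => hs.1)
    rintro _ ⟨s, hs, rfl⟩
    exact hs.2
  · obtain ⟨A, hA, hsub⟩ := href y
    exact ⟨A, hA, fun n hn => ⟨t y n, ⟨htT y n, hsub hn⟩, hyt y n⟩⟩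
end
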